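/- Let p be a prime and r, s positive integers with s dividing r and r > s. Let N > 1 be an integer such that N − 1 divides p^{2r} − 1. Consider the cyclotomic cosets modulo N − 1 with respect to p^{2s}, with minimal representatives 0 = a_0 < a_1 < ⋯ < a_z. Let t be an index with 1 ≤ t < z such that a_t < (N − 1)/(p^{2(r−s)} + 1). Put Δ = I_{a_1} ∪ I_{a_2} ∪ ⋯ ∪ I_{a_t} and let C = E_Δ ∩ F_{p^{2s}}^{N−1} be the subfield-subcode of the code E_Δ ⊆ F_{p^{2r}}^{N−1} (evaluation at the (N−1)-th roots of unity in F_{p^{2r}}). Then C ⊆ C^{⊥_h}, where ⊥_h is the Hermitian dual on F_{p^{2s}}^{N−1} given by x·_h y = Σ_i x_i y_i^{p^s}; dim_{F_{p^{2s}}} C = card(Δ); and every nonzero codeword of C^{⊥_h} has Hamming weight at least a_{t+1}. -/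

import Mathlib

/-- The set `U` of `n`-th roots of unity in `F` (the evaluation points). -/
def rootsSet (F : Type) [Field F] [Fintype F] [DecidableEq F] (n : ℕ) : Finset F :=
  Finset.univ.filter (fun α => α ^ n = 1)

/-- The evaluation code `E_Δ ⊆ F^{n}`: the `F`-span of the vectors `(α^d)_{α ∈ U}`, `d ∈ Δ`. -/
noncomputable def evalCode (F : Type) [Field F] [Fintype F] [DecidableEq F] (n : ℕ)
    (Δ : Set ℕ) : Submodule F (↥(rootsSet F n) → F) :=
  Submodule.span F { v | ∃ d ∈ Δ, v = fun α : ↥(rootsSet F n) => (α : F) ^ d }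

/-- The subfield-subcode `E_Δ ∩ F_{q₀}^n`. -/
noncomputable def subfieldSubcode (F : Type) [Field F] [Fintype F] [DecidableEq F]
    (n q₀ : ℕ) (Δ : Set ℕ) : Set (↥(rootsSet F n) → F) :=
  { v | v ∈ evalCode F n Δ ∧ ∀ i, v i ^ q₀ = v i }

/-- `x` is the minimal representative of its cyclotomic coset modulo `n`
with respect to `b`. -/
def IsMinRep (b n x : ℕ) : Prop :=
  x < n ∧ ∀ i : ℕ, x ≤ (x * b ^ i) % n

/-- The union `Δ = I_{a 1} ∪ ⋯ ∪ I_{a t}` of cyclotomic cosets. -/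
def unionCosets (b n t : ℕ) (a : ℕ → ℕ) : Set ℕ :=
  { x | ∃ i, 1 ≤ i ∧ i ≤ t ∧ ∃ k : ℕ, x = (a i * b ^ k) % n }

theorem FiniteField.exists_isPrimitiveRoot_of_dvd {F : Type*} [Field F] [Fintype F] {n : ℕ}
    (h : n ∣ Fintype.card F - 1) : ∃ ζ : F, IsPrimitiveRoot ζ n := by
  obtain ⟨g, hg⟩ := IsCyclic.exists_ofOrder_eq_natCard (α := Fˣ)
  rw [Nat.card_units, Nat.card_eq_fintype_card] at hg
  obtain ⟨m, hm⟩ := h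
  have hpos : 0 < Fintype.card F - 1 := Nat.sub_pos_of_lt Fintype.one_lt_card
  have hprim : IsPrimitiveRoot (g : F) (Fintype.card F - 1) :=
    IsPrimitiveRoot.coe_units_iff.2 (hg ▸ IsPrimitiveRoot.orderOf g)
  exact ⟨_, hprim.pow hpos (hm.trans (mul_comm _ _))⟩

section RootsSet

variable {F : Type} [Field F] [Fintype F] [DecidableEq F] {n : ℕ}

theorem mem_rootsSet {α : F} : α ∈ rootsSet F n ↔ α ^ n = 1 := by
  simp [rootsSet]

theorem card_rootsSet (hn : 0 < n) (h : n ∣ Fintype.card F - 1) : (rootsSet F n).card = n := by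
  obtain ⟨ζ, hζ⟩ := FiniteField.exists_isPrimitiveRoot_of_dvd h
  have : rootsSet F n = Polynomial.nthRootsFinset n (1 : F) := by
    ext x
    rw [mem_rootsSet, Polynomial.mem_nthRootsFinset hn]
  rw [this, hζ.card_nthRootsFinset]

theorem pow_mod_of_mem_rootsSet (α : rootsSet F n) (d : ℕ) : (α : F) ^ (d % n) = (α : F) ^ d := by
  conv_rhs => rw [← Nat.div_add_mod d n, pow_add, pow_mul, mem_rootsSet.1 α.2, one_pow, one_mul]

theorem sum_rootsSet_pow_eq_zero (h : n ∣ Fintype.card F - 1) {d : ℕ} (hd : ¬ n ∣ d) :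
    ∑ α : rootsSet F n, (α : F) ^ d = 0 := by
  obtain ⟨ζ, hζ⟩ := FiniteField.exists_isPrimitiveRoot_of_dvd h
  have hn : n ≠ 0 := by
    rintro rfl
    exact (Nat.sub_pos_of_lt (Fintype.one_lt_card (α := F))).ne' (zero_dvd_iff.1 h)
  have hζ0 : ζ ≠ 0 := hζ.ne_zero hn
  rw [Finset.sum_coe_sort (rootsSet F n) (fun α => α ^ d)]
  have hshift : ∑ α ∈ rootsSet F n, (ζ * α) ^ d = ∑ α ∈ rootsSet F n, α ^ d := by
    refine Finset.sum_nbij' (fun α => ζ * α) (fun α => ζ⁻¹ * α) ?_ ?_ ?_ ?_ ?_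
    · intro α hα
      rw [mem_rootsSet] at hα ⊢
      rw [mul_pow, hζ.pow_eq_one, hα, one_mul]
    · intro α hα
      rw [mem_rootsSet] at hα ⊢
      rw [mul_pow, inv_pow, hζ.pow_eq_one, hα, inv_one, one_mul]
    · intro α _
      simp [hζ0]
    · intro α _
      simp [hζ0]
    · intro α _
      rfl
  simp_rw [mul_pow] at hshift
  rw [← Finset.mul_sum] at hshift
  have hne : ζ ^ d ≠ 1 := fun h1 => hd (hζ.dvd_of_pow_eq_one d h1)
  by_contra h0
  exact hne (mul_right_cancel₀ h0 (by rw [hshift, one_mul]))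

theorem linearIndependent_rootsSet_pow (hn : 0 < n) (h : n ∣ Fintype.card F - 1) {Δ : Set ℕ}
    (hΔ : ∀ d ∈ Δ, d < n) :
    LinearIndependent F (fun (d : Δ) (α : rootsSet F n) => (α : F) ^ (d : ℕ)) := by
  rw [linearIndependent_iff']
  intro s c hc
  let P : Polynomial F := ∑ d ∈ s, Polynomial.monomial (d : ℕ) (c d)
  have hP : P = 0 := by
    refine P.eq_zero_of_natDegree_lt_card_of_eval_eq_zero' (rootsSet F n) ?_ ?_
    · intro α hα
      have := congrFun hc ⟨α, hα⟩
      simpa [P, Polynomial.eval_finsetSum] using this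
    · rw [card_rootsSet hn h]
      refine lt_of_le_of_lt (Polynomial.natDegree_sum_le_of_forall_le (n := n - 1) _ _ ?_)
        (Nat.sub_lt hn one_pos)
      intro d _
      exact (Polynomial.natDegree_monomial_le _).trans (Nat.le_sub_one_of_lt (hΔ d d.2))
  intro d hd
  have := congrArg (fun R => Polynomial.coeff R (d : ℕ)) hP
  simpa [P, Polynomial.finsetSum_coeff, Polynomial.coeff_monomial, Subtype.coe_inj, hd] using this

theorem evalCode_eq_span_range (Δ : Set ℕ) :
    evalCode F n Δ =
      Submodule.span F (Set.range fun (d : Δ) (α : rootsSet F n) => (α : F) ^ (d : ℕ)) := by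
  refine congrArg (Submodule.span F) (Set.ext fun v => ?_)
  constructor
  · rintro ⟨d, hd, rfl⟩
    exact ⟨⟨d, hd⟩, rfl⟩
  · rintro ⟨d, rfl⟩
    exact ⟨d, d.2, rfl⟩

theorem finrank_evalCode (hn : 0 < n) (h : n ∣ Fintype.card F - 1) {Δ : Set ℕ}
    (hΔ : ∀ d ∈ Δ, d < n) : Module.finrank F (evalCode F n Δ) = Nat.card Δ := by
  have : Finite Δ := (Set.finite_lt_nat n).subset hΔ
  have := Fintype.ofFinite Δ
  rw [evalCode_eq_span_range, finrank_span_eq_card (linearIndependent_rootsSet_pow hn h hΔ),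
    Nat.card_eq_fintype_card]

/-- If `Δ` is stable under multiplication by `p ^ e` modulo `n`, then `evalCode F n Δ` is stable
under the coordinatewise `p ^ e`-th power. -/
theorem pow_mem_evalCode (p e : ℕ) [ExpChar F p] {Δ : Set ℕ}
    (hΔ : ∀ d ∈ Δ, d * p ^ e % n ∈ Δ) {v : rootsSet F n → F} (hv : v ∈ evalCode F n Δ) :
    (fun i => v i ^ p ^ e) ∈ evalCode F n Δ := by
  induction hv using Submodule.span_induction with
  | mem v hv =>
    obtain ⟨d, hd, rfl⟩ := hv
    refine Submodule.subset_span ⟨_, hΔ d hd, ?_⟩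
    funext α
    rw [pow_mod_of_mem_rootsSet, pow_mul]
  | zero =>
    convert Submodule.zero_mem (evalCode F n Δ) using 1
    funext
    simp [(expChar_pos F p).ne']
  | add v w _ _ hv hw =>
    have : (fun i => (v + w) i ^ p ^ e) = (fun i => v i ^ p ^ e) + fun i => w i ^ p ^ e := by
      funext i
      simp [add_pow_expChar_pow]
    exact this ▸ Submodule.add_mem _ hv hw
  | smul c v _ hv =>
    have : (fun i => (c • v) i ^ p ^ e) = c ^ p ^ e • fun i => v i ^ p ^ e := by
      funext i
      simp [mul_pow]
    exact this ▸ Submodule.smul_mem _ _ hv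

theorem sum_mul_pow_eq_zero_of_mem_evalCode (p e : ℕ) [ExpChar F p]
    (h : n ∣ Fintype.card F - 1) {Δ : Set ℕ}
    (hΔ : ∀ d ∈ Δ, ∀ d' ∈ Δ, ¬ n ∣ d + d' * p ^ e) {v w : rootsSet F n → F}
    (hv : v ∈ evalCode F n Δ) (hw : w ∈ evalCode F n Δ) : ∑ i, v i * w i ^ p ^ e = 0 := by
  induction hv using Submodule.span_induction with
  | mem v hv =>
    obtain ⟨d, hd, rfl⟩ := hv
    induction hw using Submodule.span_induction with
    | mem w hw =>
      obtain ⟨d', hd', rfl⟩ := hw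
      simpa only [pow_add, pow_mul] using sum_rootsSet_pow_eq_zero h (hΔ d hd d' hd')
    | zero => simp [(expChar_pos F p).ne']
    | add v w _ _ hv hw =>
      simp only [Pi.add_apply, add_pow_expChar_pow, mul_add, Finset.sum_add_distrib, hv, hw,
        add_zero]
    | smul c v _ hv =>
      simp only [Pi.smul_apply, smul_eq_mul, mul_pow, mul_left_comm _ (c ^ p ^ e),
        ← Finset.mul_sum, hv, mul_zero]
  | zero => simp
  | add v w _ _ hv hw => simp only [Pi.add_apply, add_mul, Finset.sum_add_distrib, hv, hw, add_zero]
  | smul c v _ hv =>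
    simp only [Pi.smul_apply, smul_eq_mul, mul_assoc, ← Finset.mul_sum, hv, mul_zero]

/-- The BCH bound. -/
theorem le_card_support_of_sum_pow_mul_eq_zero {k : ℕ} (hn : n ≠ 0) {w : rootsSet F n → F}
    (hw : ∀ d, 0 < d → d < k → ∑ i : rootsSet F n, (i : F) ^ d * w i = 0) (hw0 : w ≠ 0) :
    k ≤ (Finset.univ.filter (fun i => w i ≠ 0)).card := by
  by_contra! hlt
  obtain ⟨j, hj⟩ := Function.ne_iff.1 hw0
  set T := Finset.univ.filter (fun i => w i ≠ 0) with hT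
  have hjT : j ∈ T := by simpa [hT] using hj
  let P : Polynomial F := Polynomial.X * ∏ i ∈ T.erase j, (Polynomial.X - Polynomial.C (i : F))
  have hdeg : P.natDegree < k := by
    refine lt_of_le_of_lt Polynomial.natDegree_mul_le ?_
    rw [Polynomial.natDegree_X, Polynomial.natDegree_finsetProd_X_sub_C_eq_card,
      Finset.card_erase_of_mem hjT]
    have := Finset.card_pos.2 ⟨j, hjT⟩
    omega
  have hsum : ∑ i : rootsSet F n, P.eval (i : F) * w i = 0 := by
    simp_rw [Polynomial.eval_eq_sum_range, Finset.sum_mul]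
    rw [Finset.sum_comm]
    refine Finset.sum_eq_zero fun d hd => ?_
    rcases Nat.eq_zero_or_pos d with rfl | hd0
    · simp [P]
    · simp_rw [mul_assoc]
      rw [← Finset.mul_sum, hw d hd0 (by rw [Finset.mem_range] at hd; omega), mul_zero]
  have hj0 : (j : F) ≠ 0 := by
    intro h0
    have := mem_rootsSet.1 j.2
    simp [h0, hn] at this
  rw [Finset.sum_eq_single j] at hsum
  · rcases mul_eq_zero.1 hsum with h0 | h0
    · rw [Polynomial.eval_mul, Polynomial.eval_X, Polynomial.eval_prod] at h0
      rcases mul_eq_zero.1 h0 with h0 | h0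
      · exact hj0 h0
      · obtain ⟨i, hi, h0⟩ := Finset.prod_eq_zero_iff.1 h0
        rw [Polynomial.eval_sub, Polynomial.eval_X, Polynomial.eval_C, sub_eq_zero] at h0
        exact (Finset.mem_erase.1 hi).1 (Subtype.ext h0.symm)
    · exact hj h0
  · intro i _ hij
    by_cases hi : w i = 0
    · rw [hi, mul_zero]
    · have : i ∈ T.erase j := Finset.mem_erase.2 ⟨hij, by simpa [hT] using hi⟩
      rw [Polynomial.eval_mul, Polynomial.eval_prod, Finset.prod_eq_zero this (by simp), mul_zero,
        zero_mul]
  · simp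

end RootsSet

section Descent

variable {K F ι : Type*} [Field K] [Field F] [Algebra K F]

variable (K) in
/-- The vectors over the subfield `K` that lie in a subspace `E` of `ι → F`. -/
def Submodule.subfieldPart (E : Submodule F (ι → F)) :
    Submodule K (ι → K) :=
  (E.restrictScalars K).comap ((Algebra.linearMap K F).compLeft ι)

theorem Submodule.mem_subfieldPart {E : Submodule F (ι → F)} {x : ι → K} :
    x ∈ E.subfieldPart K ↔ (fun i => algebraMap K F (x i)) ∈ E :=
  Iff.rfl

theorem LinearIndependent.algebraMap_comp {κ : Type*} {b : κ → ι → K}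
    (hb : LinearIndependent K b) :
    LinearIndependent F (fun j i => algebraMap K F (b j i)) := by
  rw [linearIndependent_iff'] at hb ⊢
  intro s c hc j hj
  refine (Module.forall_dual_apply_eq_zero_iff K (c j)).1 fun f => ?_
  refine hb s (fun j => f (c j)) ?_ j hj
  funext i
  have := congrArg f (congrFun hc i)
  simpa only [Finset.sum_apply, Pi.smul_apply, Pi.zero_apply, smul_eq_mul, map_sum, map_zero,
    mul_comm _ (algebraMap K F _), ← Algebra.smul_def, map_smul, mul_comm (b _ i)] using this

/-- Galois descent: a Frobenius-stable subspace is spanned by its vectors over the subfield. -/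
theorem span_subfieldPart [Finite F] {E : Submodule F (ι → F)}
    (hE : ∀ v ∈ E, (fun i => v i ^ Nat.card K) ∈ E) :
    Submodule.span F ((fun (x : ι → K) i => algebraMap K F (x i)) '' E.subfieldPart K) = E := by
  have := Finite.of_injective _ (FaithfulSMul.algebraMap_injective K F)
  refine le_antisymm (Submodule.span_le.2 ?_) fun v hv => ?_
  · rintro _ ⟨x, hx, rfl⟩
    exact hx
  have hiter : ∀ k : ℕ, ∀ v ∈ E, (fun i => v i ^ Nat.card K ^ k) ∈ E := by
    intro k
    induction k with
    | zero => simp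
    | succ k ih =>
      intro v hv
      simpa only [pow_succ, pow_mul] using hE _ (ih v hv)
  have htr : ∀ v ∈ E, (fun i => Algebra.trace K F (v i)) ∈ E.subfieldPart K := by
    intro v hv
    rw [Submodule.mem_subfieldPart]
    simp_rw [FiniteField.algebraMap_trace_eq_sum_pow]
    have := E.sum_mem fun k (_ : k ∈ Finset.range (Module.finrank K F)) => hiter k v hv
    convert this using 1
    funext i
    simp
  let b := Module.finBasis K F
  have hv' : v = ∑ j, b.traceDual j • fun i => algebraMap K F (Algebra.trace K F (b j * v i)) := by
    funext i
    conv_lhs => rw [← b.traceDual.sum_repr (v i)]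
    simp [Algebra.smul_def, mul_comm]
  rw [hv']
  refine Submodule.sum_mem _ fun j _ => Submodule.smul_mem _ _ (Submodule.subset_span ?_)
  exact ⟨_, htr _ (E.smul_mem (b j) hv), rfl⟩

theorem finrank_subfieldPart [Finite F] [Finite ι] {E : Submodule F (ι → F)}
    (hE : ∀ v ∈ E, (fun i => v i ^ Nat.card K) ∈ E) :
    Module.finrank K (E.subfieldPart K) = Module.finrank F E := by
  have := Finite.of_injective _ (FaithfulSMul.algebraMap_injective K F)
  let b := Module.finBasis K (E.subfieldPart K)
  have hb : LinearIndependent K (fun j => (b j : ι → K)) :=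
    b.linearIndependent.map' (E.subfieldPart K).subtype (Submodule.ker_subtype _)
  have hspan : Submodule.span F (Set.range fun j i => algebraMap K F ((b j : ι → K) i)) = E := by
    conv_rhs => rw [← span_subfieldPart hE]
    refine le_antisymm (Submodule.span_mono ?_) (Submodule.span_le.2 ?_)
    · rintro _ ⟨j, rfl⟩
      exact ⟨_, (b j).2, rfl⟩
    · rintro _ ⟨x, hx, rfl⟩
      have hx' := congrArg Subtype.val (b.sum_repr ⟨x, hx⟩)
      have : (fun i => algebraMap K F (x i)) = ∑ j, algebraMap K F (b.repr ⟨x, hx⟩ j) •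
          fun i => algebraMap K F ((b j : ι → K) i) := by
        funext i
        have hxi : x i = _ := (congrFun hx' i).symm
        rw [hxi]
        simp [-Module.Basis.sum_repr, Algebra.smul_def]
      change (fun i => algebraMap K F (x i)) ∈ _
      rw [this]
      exact Submodule.sum_mem _ fun j _ =>
        Submodule.smul_mem _ _ (Submodule.subset_span ⟨j, rfl⟩)
  rw [← congrArg (fun E : Submodule F (ι → F) => Module.finrank F E) hspan,
    finrank_span_eq_card hb.algebraMap_comp, Fintype.card_fin]

end Descent

section Cosets

variable {b n t z : ℕ} {a : ℕ → ℕ}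

theorem lt_of_mem_unionCosets (hn : 0 < n) {x : ℕ} (hx : x ∈ unionCosets b n t a) : x < n := by
  obtain ⟨i, _, _, k, rfl⟩ := hx
  exact Nat.mod_lt _ hn

theorem mul_mod_mem_unionCosets {x : ℕ} (hx : x ∈ unionCosets b n t a) :
    x * b % n ∈ unionCosets b n t a := by
  obtain ⟨i, hi, hit, k, rfl⟩ := hx
  exact ⟨i, hi, hit, k + 1, by rw [Nat.mod_mul_mod, pow_succ, mul_assoc]⟩

/-- Every coset has a minimal representative, from which its elements are recovered. -/
theorem exists_isMinRep {m x : ℕ} (hm : 0 < m) (hb : b ^ m ≡ 1 [MOD n]) (hx : x < n) :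
    ∃ y ≤ x, IsMinRep b n y ∧ ∃ k, x = y * b ^ k % n := by
  classical
  have hex : ∃ y, ∃ k, y = x * b ^ k % n := ⟨_, 0, rfl⟩
  obtain ⟨k, hk⟩ := Nat.find_spec hex
  have hmin : ∀ j, Nat.find hex ≤ x * b ^ j % n := fun j => Nat.find_min' hex ⟨j, rfl⟩
  refine ⟨Nat.find hex, ?_, ⟨?_, fun j => ?_⟩, (m - 1) * k, ?_⟩
  · simpa [Nat.mod_eq_of_lt hx] using hmin 0
  · rw [hk]
    exact Nat.mod_lt _ (by omega)
  · conv_rhs => rw [hk, Nat.mod_mul_mod, mul_assoc, ← pow_add]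
    exact hmin _
  · rw [hk, Nat.mod_mul_mod, mul_assoc, ← pow_add]
    have hexp : k + (m - 1) * k = m * k := by
      obtain ⟨m, rfl⟩ := Nat.exists_eq_add_of_lt hm
      simp only [zero_add, Nat.add_sub_cancel]
      ring
    have : x * b ^ (m * k) ≡ x * 1 [MOD n] := by
      rw [pow_mul]
      simpa using (hb.pow k).mul_left x
    rw [hexp, this, mul_one, Nat.mod_eq_of_lt hx]

theorem mem_unionCosets_of_pos_of_lt {m x : ℕ} (hm : 0 < m) (hb : b ^ m ≡ 1 [MOD n])
    (hmono : StrictMonoOn a (Set.Iic z)) (hreps : ∀ x, (∃ i ≤ z, a i = x) ↔ IsMinRep b n x)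
    (htz : t < z) (hx : 0 < x) (hxt : x < a (t + 1)) : x ∈ unionCosets b n t a := by
  have htn : a (t + 1) < n := ((hreps _).1 ⟨t + 1, htz, rfl⟩).1
  obtain ⟨y, hyx, hy, k, hk⟩ := exists_isMinRep hm hb (hxt.trans htn)
  obtain ⟨i, hiz, rfl⟩ := (hreps y).2 hy
  have hit : i < t + 1 := (hmono.lt_iff_lt hiz (Set.mem_Iic.2 htz)).1 (hyx.trans_lt hxt)
  refine ⟨i, Nat.one_le_iff_ne_zero.2 ?_, by omega, k, hk⟩
  rintro rfl
  obtain ⟨j, hjz, hj⟩ := (hreps 0).2 ⟨by omega, by simp⟩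
  have h0 : a 0 ≤ a j := hmono.monotoneOn (Set.mem_Iic.2 (Nat.zero_le z)) hjz (Nat.zero_le j)
  have : a 0 = 0 := by omega
  simp [this] at hk
  omega

theorem not_dvd_add_mul_pow {p e u v n : ℕ} (hp : 0 < p) (hu : 0 < u) {L A : ℕ} (he : e ≤ L)
    (huA : u ≤ A) (hvA : v ≤ A) (hA : A * (p ^ L + 1) < n) : ¬ n ∣ u + v * p ^ e := by
  intro hdvd
  have := Nat.le_of_dvd (by positivity) hdvd
  have : v * p ^ e ≤ A * p ^ L := Nat.mul_le_mul hvA (Nat.pow_le_pow_right hp he)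
  rw [mul_add_one] at hA
  omega

/-- No two elements `d, d'` of the cosets satisfy `d + p ^ s * d' ≡ 0 [MOD n]`: after multiplying
by a power of `p`, one may replace them by minimal representatives and the power `p ^ s` by one of
exponent at most `2 * (r - s)`, and then the sum is too small. -/
theorem not_dvd_add_mul_pow_of_mem_unionCosets {p r s : ℕ} (hp : p.Prime) (hsr : s ∣ r)
    (hrs : s < r) (hpn : p ^ (2 * r) ≡ 1 [MOD n])
    (hmono : StrictMonoOn a (Set.Iic z)) (htz : t < z)
    (hbound : a t * (p ^ (2 * (r - s)) + 1) < n) {d d' : ℕ}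
    (hd : d ∈ unionCosets (p ^ (2 * s)) n t a) (hd' : d' ∈ unionCosets (p ^ (2 * s)) n t a) :
    ¬ n ∣ d + d' * p ^ s := by
  have hpos : ∀ i, 1 ≤ i → i ≤ t → 0 < a i := fun i hi hit =>
    (Nat.zero_le _).trans_lt (hmono (Set.mem_Iic.2 (Nat.zero_le z))
      (Set.mem_Iic.2 (hit.trans htz.le)) hi)
  have hle : ∀ i, i ≤ t → a i ≤ a t := fun i hit =>
    hmono.monotoneOn (Set.mem_Iic.2 (hit.trans htz.le)) (Set.mem_Iic.2 htz.le) hit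
  obtain ⟨i, hi, hit, k, rfl⟩ := hd
  obtain ⟨j, hj, hjt, l, rfl⟩ := hd'
  intro hdvd
  obtain ⟨m, rfl⟩ := hsr
  have hs : 0 < s := Nat.pos_of_ne_zero (by rintro rfl; simp at hrs)
  have hm : 2 ≤ m := by
    by_contra! h
    interval_cases m <;> simp at hrs
  have hred : a i * (p ^ (2 * s)) ^ k + a j * (p ^ (2 * s)) ^ l * p ^ s ≡ 0 [MOD n] :=
    (((Nat.mod_modEq _ _).symm.add ((Nat.mod_modEq _ _).symm.mul_right _))).trans
      ((Nat.modEq_zero_iff_dvd).2 hdvd)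
  have hone : ∀ c, p ^ (2 * (s * m) * c) ≡ 1 [MOD n] := fun c => by
    rw [pow_mul]
    simpa using hpn.pow c
  -- clear the power of `p` on the first summand
  obtain ⟨f, hf⟩ : ∃ f, l + k * (m - 1) = f := ⟨_, rfl⟩
  have hfirst : a i + a j * p ^ (s * (2 * (f % m) + 1)) ≡ 0 [MOD n] := by
    have h1 := hred.mul_right (p ^ (2 * s * (k * (m - 1))))
    rw [zero_mul, add_mul] at h1
    refine Nat.ModEq.trans (Nat.ModEq.add ?_ ?_) h1
    · have : a i * (p ^ (2 * s)) ^ k * p ^ (2 * s * (k * (m - 1))) =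
          a i * p ^ (2 * (s * m) * k) := by
        obtain ⟨m, rfl⟩ := Nat.exists_eq_add_of_le hm
        rw [← pow_mul, mul_assoc, ← pow_add]
        congr 2
        rw [show 2 + m - 1 = m + 1 by omega]
        ring
      rw [this]
      simpa using ((hone k).mul_left (a i)).symm
    · have : a j * (p ^ (2 * s)) ^ l * p ^ s * p ^ (2 * s * (k * (m - 1))) =
          a j * p ^ (s * (2 * (f % m) + 1)) * p ^ (2 * (s * m) * (f / m)) := by
        rw [← pow_mul, mul_assoc, mul_assoc, mul_assoc (a j), ← pow_add, ← pow_add, ← pow_add]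
        congr 2
        calc 2 * s * l + (s + 2 * s * (k * (m - 1))) = s * (2 * (l + k * (m - 1)) + 1) := by ring
          _ = s * (2 * (f % m + m * (f / m)) + 1) := by rw [hf, Nat.mod_add_div]
          _ = _ := by ring
      rw [this]
      simpa using ((hone (f / m)).mul_left (a j * p ^ (s * (2 * (f % m) + 1)))).symm
  have hfm : f % m < m := Nat.mod_lt _ (by omega)
  have hL : 2 * (s * m - s) = s * (2 * (m - 1)) := by
    rw [Nat.mul_sub, Nat.mul_sub, Nat.mul_sub]
    ring_nf
  rw [hL] at hbound
  rcases Nat.lt_or_ge (f % m + 1) m with h | h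
  · exact not_dvd_add_mul_pow hp.pos (hpos i hi hit) (Nat.mul_le_mul_left s (by omega))
      (hle i hit) (hle j hjt) hbound (Nat.modEq_zero_iff_dvd.1 hfirst)
  · have hfm' : f % m = m - 1 := by omega
    have h2 : a j + a i * p ^ s ≡ 0 [MOD n] := by
      have h1 := hfirst.mul_right (p ^ s)
      rw [zero_mul, add_mul, hfm', mul_assoc, ← pow_add] at h1
      refine Nat.ModEq.trans ?_ h1
      rw [add_comm]
      refine Nat.ModEq.add_left _ ?_
      have : s * (2 * (m - 1) + 1) + s = 2 * (s * m) * 1 := by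
        obtain ⟨m, rfl⟩ := Nat.exists_eq_add_of_le hm
        rw [show 2 + m - 1 = m + 1 by omega]
        ring
      rw [this]
      simpa using ((hone 1).mul_left (a j)).symm
    exact not_dvd_add_mul_pow hp.pos (hpos j hj hjt) (Nat.le_mul_of_pos_right s (by omega))
      (hle j hjt) (hle i hit) hbound (Nat.modEq_zero_iff_dvd.1 h2)

end Cosets

/-- A finite field of characteristic `p` has a subfield of `p ^ e` elements, formed by the fixed
points of the `p ^ e`-th power map, whenever `p ^ e - 1` divides the order of its unit group. -/
theorem natCard_eqLocusField_iterateFrobenius {F : Type} [Field F] [Fintype F] [DecidableEq F]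
    (p e : ℕ) [ExpChar F p] (hpe : 1 < p ^ e) (h : p ^ e - 1 ∣ Fintype.card F - 1) :
    Nat.card ((iterateFrobenius F p e).eqLocusField (RingHom.id F)) = p ^ e := by
  have h0 : (0 : F) ∉ rootsSet F (p ^ e - 1) := by
    rw [mem_rootsSet, zero_pow (by omega)]
    exact zero_ne_one
  have hset : (((iterateFrobenius F p e).eqLocusField (RingHom.id F) : Subfield F) : Set F) =
      ((insert 0 (rootsSet F (p ^ e - 1)) : Finset F) : Set F) := by
    ext x
    have hmem : x ∈ (iterateFrobenius F p e).eqLocusField (RingHom.id F) ↔ x ^ p ^ e = x :=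
      Iff.rfl
    rw [SetLike.mem_coe, hmem, Finset.mem_coe, Finset.mem_insert, mem_rootsSet]
    obtain ⟨q, hq⟩ : ∃ q, p ^ e = q + 1 := ⟨p ^ e - 1, by omega⟩
    rw [hq, Nat.add_sub_cancel, pow_succ]
    constructor
    · intro hx
      by_cases hx0 : x = 0
      · exact Or.inl hx0
      · exact Or.inr (mul_right_cancel₀ hx0 (hx.trans (one_mul x).symm))
    · rintro (rfl | hx)
      · exact mul_zero _
      · rw [hx, one_mul]
  rw [← SetLike.coe_sort_coe, hset, Nat.card_coe_set_eq, Set.ncard_coe_finset,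
    Finset.card_insert_of_notMem h0, card_rootsSet (by omega) h]
  omega

/-- Proposition 6 of the paper: Hermitian self-orthogonality, dimension
and designed distance for the subfield-subcode over `F_{p^{2s}}` of the univariate code
of length `N - 1` (with `N - 1 ∣ p^{2r} - 1`) given by the cyclotomic cosets (with
respect to `p^{2s}`) of the first `t` nonzero minimal representatives, under
`a t < (N-1)/(p^{2(r-s)} + 1)`. -/
theorem univariate_subfield_subcode_hermitian_general
    (p r s z t N : ℕ) (hp : p.Prime) (hs : 0 < s) (hsr : s ∣ r) (hrs : s < r)
    (hN : 1 < N) (hNdvd : (N - 1) ∣ (p ^ (2 * r) - 1))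
    (F : Type) [Field F] [Fintype F] [DecidableEq F]
    (hF : Fintype.card F = p ^ (2 * r))
    (a : ℕ → ℕ)
    (hmono : StrictMonoOn a (Set.Iic z))
    (hreps : ∀ x : ℕ, (∃ i ≤ z, a i = x) ↔ IsMinRep (p ^ (2 * s)) (N - 1) x)
    (ht : 1 ≤ t) (htz : t < z)
    (hbound : a t * (p ^ (2 * (r - s)) + 1) < N - 1) :
    (∀ x ∈ subfieldSubcode F (N - 1) (p ^ (2 * s))
        (unionCosets (p ^ (2 * s)) (N - 1) t a),
     ∀ y ∈ subfieldSubcode F (N - 1) (p ^ (2 * s))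
        (unionCosets (p ^ (2 * s)) (N - 1) t a),
      ∑ i, x i * y i ^ (p ^ s) = 0) ∧
    Nat.card (subfieldSubcode F (N - 1) (p ^ (2 * s))
        (unionCosets (p ^ (2 * s)) (N - 1) t a)) =
      (p ^ (2 * s)) ^ (Nat.card (unionCosets (p ^ (2 * s)) (N - 1) t a)) ∧
    (∀ y : ↥(rootsSet F (N - 1)) → F,
      (∀ i, y i ^ (p ^ (2 * s)) = y i) →
      (∀ x ∈ subfieldSubcode F (N - 1) (p ^ (2 * s))
          (unionCosets (p ^ (2 * s)) (N - 1) t a),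
        ∑ i, x i * y i ^ (p ^ s) = 0) →
      y ≠ 0 →
      a (t + 1) ≤ (Finset.univ.filter (fun i => y i ≠ 0)).card) := by
  classical
  have : Fact p.Prime := ⟨hp⟩
  have hcharP : CharP F p := charP_of_card_eq_prime_pow hF
  have hexp : ExpChar F p := ExpChar.prime hp
  set n := N - 1 with hn_def
  have hn : 0 < n := by omega
  have hnF : n ∣ Fintype.card F - 1 := hF ▸ hNdvd
  set Δ := unionCosets (p ^ (2 * s)) n t a with hΔ_def
  have hpn : p ^ (2 * r) ≡ 1 [MOD n] :=
    ((Nat.modEq_iff_dvd' (Nat.one_le_pow _ _ hp.pos)).2 hNdvd).symm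
  have hr : 0 < r := by omega
  have hbn : (p ^ (2 * s)) ^ r ≡ 1 [MOD n] := by
    rw [← pow_mul, show 2 * s * r = 2 * r * s by ring, pow_mul]
    simpa using hpn.pow s
  have hQ : 1 < p ^ (2 * s) := Nat.one_lt_pow (by omega) hp.one_lt
  have hQdvd : p ^ (2 * s) - 1 ∣ Fintype.card F - 1 := by
    obtain ⟨m, rfl⟩ := hsr
    rw [hF, ← mul_assoc, pow_mul p (2 * s)]
    simpa only [one_pow] using Nat.sub_dvd_pow_sub_pow (p ^ (2 * s)) 1 m
  let K := (iterateFrobenius F p (2 * s)).eqLocusField (RingHom.id F)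
  have hK : Nat.card K = p ^ (2 * s) := natCard_eqLocusField_iterateFrobenius p (2 * s) hQ hQdvd
  have hE : ∀ v ∈ evalCode F n Δ, (fun i => v i ^ Nat.card K) ∈ evalCode F n Δ := by
    intro v hv
    rw [hK]
    exact pow_mem_evalCode p (2 * s) (fun d hd => mul_mod_mem_unionCosets hd) hv
  refine ⟨fun x hx y hy => ?_, ?_, fun y _ hy hy0 => ?_⟩
  · exact sum_mul_pow_eq_zero_of_mem_evalCode p s hnF
      (fun d hd d' hd' => not_dvd_add_mul_pow_of_mem_unionCosets hp hsr hrs hpn hmono htz hbound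
        hd hd') hx.1 hy.1
  · let e : subfieldSubcode F n (p ^ (2 * s)) Δ ≃ (evalCode F n Δ).subfieldPart K :=
      { toFun := fun v => ⟨fun i => ⟨v.1 i, v.2.2 i⟩, v.2.1⟩
        invFun := fun x => ⟨fun i => x.1 i, x.2, fun i => (x.1 i).2⟩
        left_inv := fun _ => rfl
        right_inv := fun _ => rfl }
    rw [Nat.card_congr e, Module.natCard_eq_pow_finrank (K := K), finrank_subfieldPart hE,
      finrank_evalCode hn hnF fun d hd => lt_of_mem_unionCosets hn hd, hK]
  · have hort : ∀ v ∈ evalCode F n Δ, ∑ i, v i * y i ^ p ^ s = 0 := by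
      intro v hv
      rw [← span_subfieldPart hE] at hv
      induction hv using Submodule.span_induction with
      | mem v hv =>
        obtain ⟨x, hx, rfl⟩ := hv
        exact hy _ ⟨hx, fun i => (x i).2⟩
      | zero => simp
      | add v w _ _ hv hw =>
        simp only [Pi.add_apply, add_mul, Finset.sum_add_distrib, hv, hw, add_zero]
      | smul c v _ hv =>
        simp only [Pi.smul_apply, smul_eq_mul, mul_assoc, ← Finset.mul_sum, hv, mul_zero]
    have hps : p ^ s ≠ 0 := pow_ne_zero _ hp.ne_zero
    have hw0 : (fun i => y i ^ p ^ s) ≠ 0 := by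
      obtain ⟨i, hi⟩ := Function.ne_iff.1 hy0
      exact Function.ne_iff.2 ⟨i, pow_ne_zero _ hi⟩
    have := le_card_support_of_sum_pow_mul_eq_zero (k := a (t + 1)) hn.ne' (fun d hd hdt =>
      hort _ (Submodule.subset_span
        ⟨d, mem_unionCosets_of_pos_of_lt hr hbn hmono hreps htz hd hdt, rfl⟩)) hw0
    simpa only [ne_eq, pow_eq_zero_iff hps] using this
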